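/- Let D > 1 be a squarefree integer with D ≡ 1 (mod 4) and let χ be the primitive quadratic Dirichlet character modulo D, with Gauss sum τ(χ) := Σ_{d mod D} χ(d)·e(d/D). Let 0 ≤ θ < 1/4 and C > 0, and let λ : ℕ⁺ → ℂ satisfy: λ(1) = 1; |λ(n)| ≤ C·n^θ for all n; the Hecke relation λ(m)·λ(n) = Σ_{d ∣ gcd(m,n)} χ(d)·λ(mn/d²) for all m, n; and the self-twist property λ(n)·χ(n) = λ(n) for all n coprime to D. Let s₁, s₂ ∈ ℂ with 5/4 < Re(s₁) < 3/2 and Re(s₁) + θ < Re(s₂) < 3/2. Then Σ_{m≥1} λ(m)·m^{−(1−s₁+s₂)} · Σ_{c≥1, D∣c} c^{−2s₁} · Σ_{d ∈ (ℤ/cℤ)ˣ} χ(d)·e(−m·d̄/c) = τ(χ)·D^{−2s₁} · (Σ_{n≥1} λ(n)·n^{−(s₁+s₂)}) · (Σ_{n≥1} λ(n)·χ(n)·n^{−(1−s₁+s₂)}) · (Σ_{b≥1, gcd(b,D)=1} μ(b)·b^{−(1+2s₂)}) · (Σ_{c≥1} μ(c)·χ(c)·c^{−2s₁}), where d̄ denotes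 the multiplicative inverse of d modulo c, and all sums converge absolutely. (This identity, proven in the paper via its Gauss-sum and Hecke-relation lemmas, evaluates the residue term arising in the spectral reciprocity formula, equal to τ(χ)·D^{−2s₁}·L(s₁+s₂,g)·L^D(1−s₁+s₂,g)/(ζ^D(1+2s₂)·L(2s₁,χ)).) -/

import Mathlib

open Finset Complex Real

/-- The Gauss sum `τ(χ) = ∑_{d mod D} χ d · e(d/D)`. -/
noncomputable def gaussSumOf {D : ℕ} (χ : DirichletCharacter ℂ D) : ℂ :=
  ∑ d ∈ Finset.range D, χ (d : ZMod D) * Complex.exp (2 * π * I * ((d : ℂ) / (D : ℂ)))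

/-- The inner `c`-term `c^{-2s₁} ∑_{d ∈ (ℤ/cℤ)ˣ} χ d · e(−m d̄ / c)` (supported on `D ∣ c`). -/
noncomputable def kloosTerm (D : ℕ) (χ : DirichletCharacter ℂ D) (m c : ℕ) (s₁ : ℂ) : ℂ :=
  if D ∣ c then
    (c : ℂ) ^ (-(2 * s₁)) *
      ∑ d ∈ (Finset.range c).filter (fun d => Nat.Coprime d c),
        χ (d : ZMod D) *
          Complex.exp (-(2 * π * I) * (((m * ((d : ZMod c)⁻¹).val : ℕ) : ℂ) / (c : ℂ)))
  else 0

theorem Int.exists_dvd_sub_and_dvd_sub {e f : ℤ} (h : IsCoprime e f) (y x : ℤ) :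
    ∃ z : ℤ, e ∣ z - y ∧ f ∣ z - x := by
  obtain ⟨u, v, huv⟩ := h
  exact ⟨y * (v * f) + x * (u * e),
    ⟨u * (x - y), by linear_combination y * huv⟩,
    ⟨v * (y - x), by linear_combination x * huv⟩⟩

namespace DirichletCharacter

variable {D : ℕ} {χ : DirichletCharacter ℂ D}

theorem sq_apply_eq_one_of_ne_zero (hquad : χ ^ 2 = 1) {x : ZMod D} (hx : χ x ≠ 0) :
    χ x ^ 2 = 1 := by
  have hu : IsUnit x := by
    by_contra h
    exact hx (χ.map_nonunit h)
  rw [← MulChar.pow_apply' χ two_ne_zero, hquad, MulChar.one_apply hu]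

theorem apply_eq_one_of_sq_dvd (hquad : χ ^ 2 = 1) {e f : ℕ} (hef : e * f = D)
    (hcop : IsCoprime (e : ℤ) f) {a y : ℤ} (ha : χ a ≠ 0) (he : (e : ℤ) ∣ a - y ^ 2)
    (hf : (f : ℤ) ∣ a - 1) : χ a = 1 := by
  obtain ⟨z, hz₁, hz₂⟩ := Int.exists_dvd_sub_and_dvd_sub hcop y 1
  have h₁ : (e : ℤ) ∣ a - z ^ 2 := by
    exact (dvd_sub he (hz₁.mul_right (z + y))).trans (dvd_of_eq (by ring))
  have h₂ : (f : ℤ) ∣ a - z ^ 2 := by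
    exact (dvd_sub hf (hz₂.mul_right (z + 1))).trans (dvd_of_eq (by ring))
  have h : ((D : ℕ) : ℤ) ∣ a - z ^ 2 := by
    rw [← hef]; push_cast; exact hcop.mul_dvd h₁ h₂
  have h' : (a : ZMod D) = (z : ZMod D) ^ 2 := by
    have := (ZMod.intCast_zmod_eq_zero_iff_dvd _ _).mpr h
    push_cast at this
    exact sub_eq_zero.mp this
  rw [h', map_pow] at ha ⊢
  exact sq_apply_eq_one_of_ne_zero hquad (fun h0 ↦ ha (by rw [h0]; simp))

theorem intCast_eq_of_dvd {e f : ℕ} (hef : e * f = D) (hcop : IsCoprime (e : ℤ) f) {a b : ℤ}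
    (he : (e : ℤ) ∣ a - b) (hf : (f : ℤ) ∣ a - b) : (a : ZMod D) = b := by
  have h : ((D : ℕ) : ℤ) ∣ a - b := by
    rw [← hef]; push_cast; exact hcop.mul_dvd he hf
  have := (ZMod.intCast_zmod_eq_zero_iff_dvd _ _).mpr h
  push_cast at this
  exact sub_eq_zero.mp this

theorem apply_sq_eq_one_of_dvd {e f : ℕ} (hef : e * f = D) (hcop : IsCoprime (e : ℤ) f) {a : ℤ}
    (he : (e : ℤ) ∣ a + 1) (hf : (f : ℤ) ∣ a - 1) : χ a ^ 2 = 1 := by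
  have : ((a ^ 2 : ℤ) : ZMod D) = ((1 : ℤ) : ZMod D) :=
    intCast_eq_of_dvd hef hcop
      ((he.mul_right (a - 1)).trans (dvd_of_eq (by ring)))
      ((hf.mul_right (a + 1)).trans (dvd_of_eq (by ring)))
  rw [← map_pow]
  push_cast at this
  rw [this, map_one]

theorem exists_apply_ne_one_of_isPrimitive [NeZero D] (hprim : χ.IsPrimitive) {f : ℕ}
    (hf : f ∣ D) (hlt : f < D) : ∃ x : ℤ, (f : ℤ) ∣ x - 1 ∧ χ x ≠ 0 ∧ χ x ≠ 1 := by
  have hnf : ¬ χ.FactorsThrough f := by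
    intro h
    have h1 := Nat.le_of_dvd (Nat.pos_of_dvd_of_pos hf (NeZero.pos D))
      (conductor_dvd_of_mem_conductorSet (χ := χ) h)
    rw [isPrimitive_def] at hprim
    omega
  rw [factorsThrough_iff_ker_unitsMap hf, SetLike.not_le_iff_exists] at hnf
  obtain ⟨x, hx, hx'⟩ := hnf
  rw [MonoidHom.mem_ker] at hx hx'
  refine ⟨((x : ZMod D).val : ℤ), ?_, ?_, ?_⟩
  · have := congrArg Units.val hx
    rw [ZMod.unitsMap_val, Units.val_one] at this
    rw [← ZMod.intCast_zmod_eq_zero_iff_dvd]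
    push_cast
    rw [sub_eq_zero, ← this, ZMod.natCast_val]
  · simpa using (x.isUnit.map χ).ne_zero
  · intro h
    apply hx'
    ext
    simpa using h

theorem apply_eq_χ₄_of_prime [NeZero D] (hquad : χ ^ 2 = 1) (hprim : χ.IsPrimitive) {p f : ℕ}
    (hp : p.Prime) (hp2 : p ≠ 2) (hef : p * f = D) (hcop : IsCoprime (p : ℤ) f) {a : ℤ}
    (he : (p : ℤ) ∣ a + 1) (hf : (f : ℤ) ∣ a - 1) : χ a = ((ZMod.χ₄ (p : ZMod 4) : ℤ) : ℂ) := by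
  have : Fact p.Prime := ⟨hp⟩
  have hsq : χ a ^ 2 = 1 := apply_sq_eq_one_of_dvd hef hcop he hf
  have ha0 : χ a ≠ 0 := fun h ↦ by simp [h] at hsq
  have hsquare : ∀ x : ZMod p, IsSquare x → ∀ b : ℤ, (b : ZMod p) = x →
      ∃ y : ℤ, (p : ℤ) ∣ b - y ^ 2 := by
    rintro _ ⟨y, rfl⟩ b hb
    refine ⟨y.val, ?_⟩
    rw [← ZMod.intCast_zmod_eq_zero_iff_dvd]
    push_cast
    rw [hb, ZMod.natCast_zmod_val]; ring
  have hap : (a : ZMod p) = -1 := by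
    have := (ZMod.intCast_zmod_eq_zero_iff_dvd _ _).mpr he
    push_cast at this
    exact eq_neg_of_add_eq_zero_left this
  have hpodd := hp.eq_two_or_odd.resolve_left hp2
  rcases (by omega : p % 4 = 1 ∨ p % 4 = 3) with h4 | h4
  · rw [ZMod.χ₄_nat_one_mod_four h4]
    obtain ⟨y, hy⟩ := hsquare (-1) (ZMod.exists_sq_eq_neg_one_iff.mpr (by omega)) a hap
    simpa using apply_eq_one_of_sq_dvd hquad hef hcop ha0 hy hf
  · rw [ZMod.χ₄_nat_three_mod_four h4]
    have hD := NeZero.pos D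
    have hf0 : 0 < f := Nat.pos_of_ne_zero (by rintro rfl; omega)
    obtain ⟨x, hx1, hx0, hxne⟩ := exists_apply_ne_one_of_isPrimitive hprim
      (Dvd.intro_left _ hef) (by nlinarith [hp.two_le] : f < D)
    have hxp : ¬ IsSquare (x : ZMod p) := fun h ↦ by
      obtain ⟨y, hy⟩ := hsquare _ h x rfl
      exact hxne (apply_eq_one_of_sq_dvd hquad hef hcop hx0 hy hx1)
    have hneg : ¬ IsSquare (-1 : ZMod p) := by
      rw [ZMod.exists_sq_eq_neg_one_iff]; omega
    have hmul : IsSquare (((a * x : ℤ)) : ZMod p) := by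
      push_cast
      rw [hap]
      rw [← quadraticChar_neg_one_iff_not_isSquare] at hxp hneg
      have h1 : quadraticChar (ZMod p) (-1 * x) = 1 := by rw [map_mul, hxp, hneg]; norm_num
      have h0 : (-1 * x : ZMod p) ≠ 0 := fun h0 ↦ by simp [h0] at h1
      exact (quadraticChar_one_iff_isSquare h0).mp h1
    obtain ⟨y, hy⟩ := hsquare _ hmul (a * x) rfl
    have hax : χ ((a * x : ℤ) : ZMod D) = 1 := by
      refine apply_eq_one_of_sq_dvd hquad hef hcop ?_ hy ?_
      · push_cast; rw [map_mul]; exact mul_ne_zero ha0 hx0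
      · exact (dvd_add (hf.mul_right x) hx1).trans (dvd_of_eq (by ring))
    push_cast at hax
    rw [map_mul] at hax
    have : χ a ≠ 1 := fun h ↦ hxne (by rw [h, one_mul] at hax; exact hax)
    push_cast
    exact (sq_eq_one_iff.mp hsq).resolve_left this

theorem apply_eq_χ₄_of_dvd [NeZero D] (hquad : χ ^ 2 = 1) (hprim : χ.IsPrimitive)
    (hsf : Squarefree D) (hodd : _root_.Odd D) {e : ℕ} : ∀ {f : ℕ} {a : ℤ}, e * f = D →
    (e : ℤ) ∣ a + 1 → (f : ℤ) ∣ a - 1 → χ a = ((ZMod.χ₄ (e : ZMod 4) : ℤ) : ℂ) := by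
  induction e using induction_on_primes with
  | zero => intro f a h; simp at h; exact absurd h.symm (NeZero.ne D)
  | one =>
    intro f a hef _ hf
    have : (a : ZMod D) = (1 : ℤ) :=
      intCast_eq_of_dvd hef (by simp [isCoprime_one_left]) (by simp) hf
    rw [this]; simp
  | prime_mul p e hp ih =>
    intro f a hef he hf
    have hp2 : p ≠ 2 := by
      rintro rfl
      rw [← hef, mul_assoc] at hodd
      exact Nat.not_odd_iff_even.mpr (even_two_mul _) hodd
    have hsf' := hsf
    rw [← hef] at hsf'
    have c1 : IsCoprime (p : ℤ) (e * f : ℕ) :=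
      Nat.isCoprime_iff_coprime.mpr (Nat.coprime_of_squarefree_mul (by rwa [← mul_assoc]))
    have c2 : IsCoprime (e : ℤ) (p * f : ℕ) :=
      Nat.isCoprime_iff_coprime.mpr
        (Nat.coprime_of_squarefree_mul (by rwa [show e * (p * f) = p * e * f by ring]))
    have c3 : IsCoprime ((p * e : ℕ) : ℤ) f :=
      Nat.isCoprime_iff_coprime.mpr (Nat.coprime_of_squarefree_mul hsf')
    obtain ⟨b, hb1, hb2⟩ := Int.exists_dvd_sub_and_dvd_sub c1 (-1) 1
    obtain ⟨c, hc1, hc2⟩ := Int.exists_dvd_sub_and_dvd_sub c2 (-1) 1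
    rw [sub_neg_eq_add] at hb1 hc1
    have hb := apply_eq_χ₄_of_prime hquad hprim hp hp2 (by rw [← hef]; ring) c1 hb1 hb2
    have hc := ih (f := p * f) (by rw [← hef]; ring) hc1 hc2
    push_cast at he hb2 hc2
    have hpd : (p : ℤ) ∣ a - b * c := by
      have h1 := (Dvd.intro _ rfl : (p : ℤ) ∣ p * e).trans he
      have h2 := (Dvd.intro _ rfl : (p : ℤ) ∣ p * f).trans hc2
      exact (dvd_add (dvd_sub h1 (hb1.mul_right c)) h2).trans (dvd_of_eq (by ring))
    have hed : (e : ℤ) ∣ a - b * c := by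
      have h1 := (Dvd.intro_left _ rfl : (e : ℤ) ∣ p * e).trans he
      have h2 := (Dvd.intro _ rfl : (e : ℤ) ∣ e * f).trans hb2
      exact (dvd_add (dvd_sub h1 (hc1.mul_right b)) h2).trans (dvd_of_eq (by ring))
    have hfd : (f : ℤ) ∣ a - b * c := by
      have h1 := (Dvd.intro_left _ rfl : (f : ℤ) ∣ e * f).trans hb2
      have h2 := (Dvd.intro_left _ rfl : (f : ℤ) ∣ p * f).trans hc2
      exact (dvd_sub (dvd_sub hf (h1.mul_right c)) h2).trans (dvd_of_eq (by ring))
    have hpe : IsCoprime (p : ℤ) e := by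
      push_cast at c1
      exact c1.of_mul_right_left
    have : (a : ZMod D) = (b * c : ℤ) :=
      intCast_eq_of_dvd hef c3 (by push_cast; exact hpe.mul_dvd hpd hed) hfd
    rw [this]
    push_cast
    rw [map_mul, hb, hc, map_mul]
    push_cast
    rfl

/-- A primitive quadratic Dirichlet character of squarefree level `D ≡ 1 [MOD 4]` is even. -/
theorem apply_neg_one_of_isPrimitive_of_sq_eq_one [NeZero D] (hquad : χ ^ 2 = 1)
    (hprim : χ.IsPrimitive) (hsf : Squarefree D) (hmod : D % 4 = 1) : χ (-1) = 1 := by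
  have := apply_eq_χ₄_of_dvd (a := -1) hquad hprim hsf (Nat.odd_iff.mpr (by omega)) (mul_one D)
    (by simp) (by simp)
  rw [ZMod.χ₄_nat_one_mod_four hmod] at this
  simpa using this

end DirichletCharacter

theorem ZMod.sum_range_natCast {M : Type*} [AddCommMonoid M] (N : ℕ) [NeZero N]
    (f : ZMod N → M) : ∑ d ∈ range N, f d = ∑ x, f x := by
  refine Finset.sum_nbij' (fun d ↦ (d : ZMod N)) ZMod.val (by simp) ?_ ?_ ?_ (by simp)
  · exact fun x _ ↦ mem_range.mpr (ZMod.val_lt x)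
  · exact fun d hd ↦ ZMod.val_cast_of_lt (mem_range.mp hd)
  · exact fun x _ ↦ ZMod.natCast_zmod_val x

theorem Finset.sum_range_mul_eq_sum_sum {M : Type*} [AddCommMonoid M] (f : ℕ → M) (m n : ℕ) :
    ∑ i ∈ range (m * n), f i = ∑ t ∈ range n, ∑ j ∈ range m, f (m * t + j) := by
  induction n with
  | zero => simp
  | succ n ih => rw [mul_add_one, sum_range_add, sum_range_succ, ih]

theorem ZMod.stdAddChar_natCast (N : ℕ) [NeZero N] (j : ℕ) :
    ZMod.stdAddChar (j : ZMod N) = Complex.exp (2 * π * I * ((j : ℂ) / N)) := by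
  have := ZMod.stdAddChar_coe (N := N) j
  push_cast at this
  rw [this, mul_div_assoc]

theorem ZMod.stdAddChar_natCast_mul (D k : ℕ) [NeZero D] [NeZero k] (j : ℕ) :
    ZMod.stdAddChar (N := D * k) ((D * j : ℕ) : ZMod (D * k)) =
      ZMod.stdAddChar (j : ZMod k) := by
  rw [ZMod.stdAddChar_natCast, ZMod.stdAddChar_natCast]
  have : (D : ℂ) ≠ 0 := NeZero.ne _
  push_cast
  rw [mul_div_mul_left _ _ this]

theorem ZMod.sum_range_stdAddChar_mul (k m : ℕ) [NeZero k] :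
    ∑ t ∈ range k, ZMod.stdAddChar ((m * t : ℕ) : ZMod k) = if k ∣ m then (k : ℂ) else 0 := by
  have h := AddChar.sum_mulShift (m : ZMod k) (ZMod.isPrimitive_stdAddChar k)
  rw [← ZMod.sum_range_natCast k (fun x ↦ ZMod.stdAddChar (x * (m : ZMod k)))] at h
  simp only [ZMod.natCast_eq_zero_iff, ZMod.card] at h
  push_cast [mul_comm] at h ⊢
  exact_mod_cast h

namespace DirichletCharacter

variable {D : ℕ} {χ : DirichletCharacter ℂ D}

theorem gaussSumOf_eq_gaussSum [NeZero D] : gaussSumOf χ = gaussSum χ ZMod.stdAddChar := by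
  rw [gaussSumOf, gaussSum, ← ZMod.sum_range_natCast D (fun x ↦ χ x * ZMod.stdAddChar x)]
  simp only [ZMod.stdAddChar_natCast]

theorem inv_eq_self_of_sq_eq_one (hquad : χ ^ 2 = 1) : χ⁻¹ = χ := by
  rw [inv_eq_iff_mul_eq_one, ← sq, hquad]

theorem sum_range_mul_stdAddChar_level [NeZero D] (hquad : χ ^ 2 = 1) (hprim : χ.IsPrimitive)
    (m : ℕ) : ∑ d ∈ range D, χ (d : ZMod D) * ZMod.stdAddChar ((m * d : ℕ) : ZMod D) =
      χ (m : ZMod D) * gaussSumOf χ := by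
  have h := gaussSum_mulShift_of_isPrimitive ZMod.stdAddChar hprim (m : ZMod D)
  rw [inv_eq_self_of_sq_eq_one hquad] at h
  rw [gaussSumOf_eq_gaussSum, ← h, gaussSum,
    ← ZMod.sum_range_natCast D (fun x ↦ χ x * (ZMod.stdAddChar.mulShift (m : ZMod D)) x)]
  simp [AddChar.mulShift_apply]

/-- The Gauss sum of `χ` over a multiple `D * k` of its level. -/
theorem sum_range_mul_stdAddChar [NeZero D] (hquad : χ ^ 2 = 1) (hprim : χ.IsPrimitive)
    (m k : ℕ) [NeZero k] :
    ∑ d ∈ range (D * k), χ (d : ZMod D) * ZMod.stdAddChar ((m * d : ℕ) : ZMod (D * k)) =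
      if k ∣ m then k * χ ((m / k : ℕ) : ZMod D) * gaussSumOf χ else 0 := by
  have h1 : ∀ t j : ℕ, χ ((D * t + j : ℕ) : ZMod D) *
      ZMod.stdAddChar ((m * (D * t + j) : ℕ) : ZMod (D * k)) =
      ZMod.stdAddChar ((m * t : ℕ) : ZMod k) *
        (χ (j : ZMod D) * ZMod.stdAddChar ((m * j : ℕ) : ZMod (D * k))) := by
    intro t j
    rw [show m * (D * t + j) = D * (m * t) + m * j by ring, Nat.cast_add (D * (m * t)),
      AddChar.map_add_eq_mul, ZMod.stdAddChar_natCast_mul]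
    push_cast
    rw [ZMod.natCast_self]
    ring_nf
  simp only [Finset.sum_range_mul_eq_sum_sum, h1]
  rw [← Finset.sum_mul_sum, ZMod.sum_range_stdAddChar_mul]
  split_ifs with h
  · obtain ⟨m', rfl⟩ := h
    rw [Nat.mul_div_cancel_left _ (NeZero.pos k), mul_assoc,
      ← sum_range_mul_stdAddChar_level hquad hprim]
    congr 1
    refine Finset.sum_congr rfl fun j _ ↦ ?_
    congr 1
    rw [ZMod.stdAddChar_natCast, ZMod.stdAddChar_natCast]
    have : (k : ℂ) ≠ 0 := NeZero.ne _
    have : (D : ℂ) ≠ 0 := NeZero.ne _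
    push_cast
    congr 1
    field_simp
  · simp

end DirichletCharacter

theorem Nat.sum_divisors_moebius (n : ℕ) :
    ∑ b ∈ n.divisors, ((ArithmeticFunction.moebius b : ℤ) : ℂ) = if n = 1 then 1 else 0 := by
  have h := congrArg (fun f ↦ f n) ArithmeticFunction.coe_zeta_mul_moebius
  simp only [ArithmeticFunction.coe_zeta_mul_apply, ArithmeticFunction.one_apply] at h
  exact_mod_cast h

theorem Nat.sum_filter_coprime_eq_sum_moebius (N r : ℕ) (hr : r ∣ N) (hN : 0 < N) (g : ℕ → ℂ) :
    ∑ d ∈ range N with d.Coprime r, g d =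
      ∑ b ∈ r.divisors, ((ArithmeticFunction.moebius b : ℤ) : ℂ) *
        ∑ d ∈ range (N / b), g (b * d) := by
  have hr0 : r ≠ 0 := by rintro rfl; simp at hr; omega
  have h1 : ∀ b ∈ r.divisors, ∑ d ∈ range (N / b), g (b * d) =
      ∑ d ∈ range N, if b ∣ d then g d else 0 := by
    intro b hb
    have hbN : b ∣ N := (Nat.dvd_of_mem_divisors hb).trans hr
    have hb0 : 0 < b := Nat.pos_of_mem_divisors hb
    rw [← Finset.sum_filter]
    refine Finset.sum_nbij' (fun d ↦ b * d) (fun d ↦ d / b) ?_ ?_ ?_ ?_ (by simp)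
    · intro d hd
      simp only [Finset.mem_filter, mem_range] at hd ⊢
      exact ⟨by rwa [Nat.lt_div_iff_mul_lt' hbN] at hd, dvd_mul_right _ _⟩
    · intro d hd
      simp only [Finset.mem_filter, mem_range] at hd ⊢
      exact Nat.div_lt_div_of_lt_of_dvd hbN hd.1
    · intro d _
      exact Nat.mul_div_cancel_left _ hb0
    · intro d hd
      exact Nat.mul_div_cancel' (Finset.mem_filter.mp hd).2
  rw [Finset.sum_congr (s₁ := r.divisors) rfl fun b hb ↦ congrArg _ (h1 b hb)]
  simp only [Finset.mul_sum]
  rw [Finset.sum_comm, Finset.sum_filter]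
  refine Finset.sum_congr rfl fun d _ ↦ ?_
  have h2 : r.divisors.filter (· ∣ d) = (Nat.gcd d r).divisors := by
    ext b
    simp only [Finset.mem_filter, Nat.mem_divisors, Nat.dvd_gcd_iff, ne_eq, Nat.gcd_eq_zero_iff]
    tauto
  simp only [mul_ite, mul_zero]
  rw [← Finset.sum_filter, h2, ← Finset.sum_mul, Nat.sum_divisors_moebius]
  simp [Nat.Coprime]

namespace DirichletCharacter

variable {D : ℕ} {χ : DirichletCharacter ℂ D}

/-- The Gauss sum of the character modulo `D * r` induced by `χ`. -/
theorem sum_coprime_mul_stdAddChar [NeZero D] (hquad : χ ^ 2 = 1) (hprim : χ.IsPrimitive)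
    (m r : ℕ) [NeZero r] :
    ∑ d ∈ range (D * r) with d.Coprime (D * r),
      χ (d : ZMod D) * ZMod.stdAddChar ((m * d : ℕ) : ZMod (D * r)) =
      ∑ p ∈ r.divisorsAntidiagonal, ((ArithmeticFunction.moebius p.1 : ℤ) : ℂ) *
        χ (p.1 : ZMod D) *
          (if p.2 ∣ m then p.2 * χ ((m / p.2 : ℕ) : ZMod D) * gaussSumOf χ else 0) := by
  have h1 : ∑ d ∈ range (D * r) with d.Coprime (D * r),
      χ (d : ZMod D) * ZMod.stdAddChar ((m * d : ℕ) : ZMod (D * r)) =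
      ∑ d ∈ range (D * r) with d.Coprime r,
        χ (d : ZMod D) * ZMod.stdAddChar ((m * d : ℕ) : ZMod (D * r)) := by
    refine Finset.sum_subset ?_ ?_
    · intro d hd
      simp only [Finset.mem_filter, Nat.coprime_mul_iff_right] at hd ⊢
      exact ⟨hd.1, hd.2.2⟩
    · intro d hd hd'
      simp only [Finset.mem_filter, Nat.coprime_mul_iff_right] at hd hd'
      have : ¬ IsUnit (d : ZMod D) := by
        rw [ZMod.isUnit_iff_coprime]; tauto
      rw [χ.map_nonunit this, zero_mul]
  rw [h1, Nat.sum_filter_coprime_eq_sum_moebius _ r (dvd_mul_left _ _) (NeZero.pos _),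
    Nat.sum_divisorsAntidiagonal (fun b k ↦ ((ArithmeticFunction.moebius b : ℤ) : ℂ) *
        χ (b : ZMod D) * (if k ∣ m then k * χ ((m / k : ℕ) : ZMod D) * gaussSumOf χ else 0))]
  refine Finset.sum_congr rfl fun b hb ↦ ?_
  obtain ⟨k, rfl⟩ := Nat.dvd_of_mem_divisors hb
  have hb0 : 0 < b := Nat.pos_of_mem_divisors hb
  have : NeZero b := ⟨hb0.ne'⟩
  have : NeZero k := ⟨fun h ↦ NeZero.ne (b * k) (by rw [h, mul_zero])⟩
  rw [Nat.mul_div_cancel_left _ hb0, show D * (b * k) / b = D * k from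
    Nat.div_eq_of_eq_mul_right hb0 (by ring), ← sum_range_mul_stdAddChar hquad hprim,
    mul_assoc ((ArithmeticFunction.moebius b : ℤ) : ℂ),
    Finset.mul_sum _ _ (χ (b : ZMod D))]
  congr 1
  refine Finset.sum_congr rfl fun d _ ↦ ?_
  push_cast
  rw [map_mul, mul_assoc]
  congr 2
  have h2 := ZMod.stdAddChar_natCast_mul b (D * k) (m * d)
  rw [ZMod.stdAddChar_natCast] at h2
  have h3 := ZMod.stdAddChar_natCast (D * (b * k)) (m * (b * d))
  push_cast at h2 h3
  rw [h3, ← h2]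
  ring_nf

theorem kloosTerm_eq [NeZero D] (hquad : χ ^ 2 = 1) (heven : χ (-1) = 1)
    (m c : ℕ) [NeZero c] (hc : D ∣ c) (s : ℂ) :
    kloosTerm D χ m c s = (c : ℂ) ^ (-(2 * s)) *
      ∑ d ∈ range c with d.Coprime c,
        χ (d : ZMod D) * ZMod.stdAddChar ((m * d : ℕ) : ZMod c) := by
  rw [kloosTerm, if_pos hc]
  congr 1
  set i : ℕ → ℕ := fun d ↦ (-(d : ZMod c)⁻¹).val with hi
  have hi_cast : ∀ d, ((i d : ℕ) : ZMod c) = -(d : ZMod c)⁻¹ := fun d ↦ ZMod.natCast_zmod_val _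
  have hmaps : ∀ d ∈ (range c).filter (·.Coprime c), i d ∈ (range c).filter (·.Coprime c) := by
    intro d hd
    simp only [Finset.mem_filter, mem_range] at hd ⊢
    refine ⟨ZMod.val_lt _, ?_⟩
    rw [← ZMod.isUnit_iff_coprime, hi_cast, IsUnit.neg_iff]
    have hu := (ZMod.isUnit_iff_coprime d c).mpr hd.2
    exact .of_mul_eq_one _ (ZMod.inv_mul_of_unit _ hu)
  have hinv : ∀ d ∈ (range c).filter (·.Coprime c), i (i d) = d := by
    intro d hd
    simp only [Finset.mem_filter, mem_range] at hd
    have hu := (ZMod.isUnit_iff_coprime d c).mpr hd.2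
    have : (-(i d : ZMod c)⁻¹) = d := by
      rw [hi_cast]
      have h1 : (-(d : ZMod c)⁻¹) * -(d : ZMod c) = 1 := by
        rw [neg_mul_neg, ZMod.inv_mul_of_unit _ hu]
      rw [ZMod.inv_eq_of_mul_eq_one _ _ _ h1, neg_neg]
    rw [hi]
    simp only
    rw [show (((-(d : ZMod c)⁻¹).val : ℕ) : ZMod c) = (i d : ZMod c) from rfl, this]
    exact ZMod.val_cast_of_lt hd.1
  refine Finset.sum_nbij' i i hmaps hmaps hinv hinv ?_
  intro d hd
  simp only [Finset.mem_filter, mem_range] at hd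
  have hu := (ZMod.isUnit_iff_coprime d c).mpr hd.2
  congr 1
  · have h1 : (d : ZMod D) * ((i d : ℕ) : ZMod D) = -1 := by
      have : (d : ZMod c) * (i d : ZMod c) = -1 := by
        rw [hi_cast, mul_neg, ZMod.mul_inv_of_unit _ hu]
      simpa only [map_mul, map_natCast, map_neg, map_one] using
        congrArg (ZMod.castHom hc (ZMod D)) this
    have h2 : χ (d : ZMod D) * χ ((i d : ℕ) : ZMod D) = 1 := by
      rw [← map_mul, h1, heven]
    have h3 : χ (d : ZMod D) ^ 2 = 1 :=
      sq_apply_eq_one_of_ne_zero hquad (left_ne_zero_of_mul_eq_one h2)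
    linear_combination (χ ((i d : ℕ) : ZMod D)) * h3 - (χ (d : ZMod D)) * h2
  · have h4 : ((m * i d : ℕ) : ZMod c) = -((m * ((d : ZMod c)⁻¹).val : ℕ) : ZMod c) := by
      push_cast
      rw [hi_cast, ZMod.natCast_zmod_val, mul_neg]
    rw [h4, AddChar.map_neg_eq_inv, ZMod.stdAddChar_natCast, ← Complex.exp_neg]
    ring_nf

end DirichletCharacter

/-- Summing over all pairs grouped by their product. -/
theorem hasSum_sum_divisorsAntidiagonal {F : ℕ × ℕ → ℂ} (hF : Summable F)
    (h0 : ∀ a b, a * b = 0 → F (a, b) = 0) :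
    HasSum (fun m : ℕ ↦ ∑ p ∈ m.divisorsAntidiagonal, F p) (∑' p, F p) := by
  refine (congrArg (HasSum · _) (funext fun m ↦ ?_)).mpr
    (hF.hasSum.tsum_fiberwise fun p : ℕ × ℕ ↦ p.1 * p.2)
  rcases eq_or_ne m 0 with rfl | hm
  · have : ∀ p : (fun p : ℕ × ℕ ↦ p.1 * p.2) ⁻¹' {0}, F p = 0 := fun p ↦ h0 _ _ p.2
    simp [this]
  · rw [show (fun p : ℕ × ℕ ↦ p.1 * p.2) ⁻¹' {m} = m.divisorsAntidiagonal by ext; simp [hm],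
      Finset.tsum_subtype' m.divisorsAntidiagonal F]

/-- Summing over all triples `(b, x, y)` grouped by the pair `(b * x, b * y)`. -/
theorem hasSum_sum_divisors_gcd {F : ℕ × ℕ × ℕ → ℂ} (hF : Summable F)
    (h0 : ∀ b x y, b = 0 ∨ x = 0 ∨ y = 0 → F (b, x, y) = 0) :
    HasSum (fun q : ℕ × ℕ ↦ ∑ b ∈ (Nat.gcd q.1 q.2).divisors, F (b, q.1 / b, q.2 / b))
      (∑' t, F t) := by
  refine (congrArg (HasSum · _) (funext fun q ↦ ?_)).mpr
    (hF.hasSum.tsum_fiberwise fun t : ℕ × ℕ × ℕ ↦ (t.1 * t.2.1, t.1 * t.2.2))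
  obtain ⟨m, n⟩ := q
  by_cases hmn : m = 0 ∨ n = 0
  · have h1 : ∀ t : (fun t : ℕ × ℕ × ℕ ↦ (t.1 * t.2.1, t.1 * t.2.2)) ⁻¹' {(m, n)},
        F t = 0 := by
      rintro ⟨⟨b, x, y⟩, ht⟩
      simp only [Set.mem_preimage, Set.mem_singleton_iff, Prod.mk.injEq] at ht
      refine h0 _ _ _ ?_
      rcases hmn with rfl | rfl
      · rcases mul_eq_zero.mp ht.1 with h | h <;> tauto
      · rcases mul_eq_zero.mp ht.2 with h | h <;> tauto
    simp only [h1, tsum_zero]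
    refine Finset.sum_eq_zero fun b _ ↦ h0 _ _ _ ?_
    rcases hmn with rfl | rfl <;> simp
  · push Not at hmn
    obtain ⟨hm, hn⟩ := hmn
    have hset : (fun t : ℕ × ℕ × ℕ ↦ (t.1 * t.2.1, t.1 * t.2.2)) ⁻¹' {(m, n)} =
        (((Nat.gcd m n).divisors.image fun b ↦ (b, m / b, n / b) : Finset (ℕ × ℕ × ℕ)) :
          Set (ℕ × ℕ × ℕ)) := by
      ext ⟨b, x, y⟩
      simp only [Set.mem_preimage, Set.mem_singleton_iff, Prod.mk.injEq, Finset.coe_image,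
        Set.mem_image, Finset.mem_coe, Nat.mem_divisors, Nat.dvd_gcd_iff, ne_eq,
        Nat.gcd_eq_zero_iff]
      constructor
      · rintro ⟨rfl, rfl⟩
        have hb : 0 < b := Nat.pos_of_ne_zero (left_ne_zero_of_mul hm)
        exact ⟨b, ⟨⟨dvd_mul_right _ _, dvd_mul_right _ _⟩, by tauto⟩, rfl,
          Nat.mul_div_cancel_left _ hb, Nat.mul_div_cancel_left _ hb⟩
      · rintro ⟨b', ⟨⟨hb1, hb2⟩, -⟩, rfl, rfl, rfl⟩
        exact ⟨Nat.mul_div_cancel' hb1, Nat.mul_div_cancel' hb2⟩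
    rw [hset, Finset.tsum_subtype' _ F, Finset.sum_image]
    intro b _ b' _ h
    exact (Prod.mk.inj h).1

theorem Nat.sum_divisors_sum_divisors_moebius_mul (g : ℕ) (H : ℕ → ℂ) :
    ∑ b ∈ g.divisors, ((ArithmeticFunction.moebius b : ℤ) : ℂ) *
      ∑ d ∈ (g / b).divisors, H (b * d) = if g = 0 then 0 else H 1 := by
  rcases eq_or_ne g 0 with rfl | hg
  · simp
  have h1 : ∀ b ∈ g.divisors, ∑ d ∈ (g / b).divisors, H (b * d) =
      ∑ e ∈ g.divisors, if b ∣ e then H e else 0 := by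
    intro b hb
    obtain ⟨k, rfl⟩ := Nat.dvd_of_mem_divisors hb
    have hb0 : 0 < b := Nat.pos_of_mem_divisors hb
    rw [← Finset.sum_filter, Nat.mul_div_cancel_left _ hb0]
    refine Finset.sum_nbij' (fun d ↦ b * d) (fun d ↦ d / b) ?_ ?_ ?_ ?_ (by simp)
    · intro d hd
      simp only [Finset.mem_filter, Nat.mem_divisors] at hd ⊢
      exact ⟨⟨mul_dvd_mul_left _ hd.1, hg⟩, dvd_mul_right _ _⟩
    · intro d hd
      simp only [Finset.mem_filter, Nat.mem_divisors] at hd ⊢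
      exact ⟨(Nat.div_dvd_iff_dvd_mul hd.2 hb0).mpr hd.1.1, right_ne_zero_of_mul hg⟩
    · intro d _
      exact Nat.mul_div_cancel_left _ hb0
    · intro d hd
      exact Nat.mul_div_cancel' (Finset.mem_filter.mp hd).2
  rw [Finset.sum_congr (s₁ := g.divisors) rfl fun b hb ↦ congrArg _ (h1 b hb)]
  simp only [Finset.mul_sum, mul_ite, mul_zero]
  rw [Finset.sum_comm]
  have h2 : ∀ e ∈ g.divisors, (∑ b ∈ g.divisors,
      if b ∣ e then ((ArithmeticFunction.moebius b : ℤ) : ℂ) * H e else 0) =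
      if e = 1 then H e else 0 := by
    intro e he
    have h3 : g.divisors.filter (· ∣ e) = e.divisors := by
      ext b
      simp only [Finset.mem_filter, Nat.mem_divisors] at he ⊢
      exact ⟨fun h ↦ ⟨h.2, ne_zero_of_dvd_ne_zero hg he.1⟩, fun h ↦ ⟨⟨h.1.trans he.1, hg⟩, h.1⟩⟩
    rw [← Finset.sum_filter, h3, ← Finset.sum_mul, Nat.sum_divisors_moebius]
    simp
  rw [Finset.sum_congr rfl h2]
  simp [hg]

/-- Möbius inversion of the Hecke relation. -/
theorem sum_moebius_mul_of_hecke {D : ℕ} {χ : DirichletCharacter ℂ D} {lam : ℕ → ℂ}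
    (hHecke : ∀ m n : ℕ, 0 < m → 0 < n →
      lam m * lam n = ∑ d ∈ (Nat.gcd m n).divisors, χ (d : ZMod D) * lam (m * n / d ^ 2))
    {m n : ℕ} (hm : 0 < m) (hn : 0 < n) :
    ∑ b ∈ (Nat.gcd m n).divisors, ((ArithmeticFunction.moebius b : ℤ) : ℂ) * χ (b : ZMod D) *
      (lam (m / b) * lam (n / b)) = lam (m * n) := by
  have h := Nat.sum_divisors_sum_divisors_moebius_mul (Nat.gcd m n)
    (fun e ↦ χ (e : ZMod D) * lam (m * n / e ^ 2))
  rw [if_neg (Nat.gcd_pos_of_pos_left _ hm).ne'] at h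
  simp only [Nat.cast_one, map_one, one_mul, one_pow, Nat.div_one] at h
  rw [← h]
  refine Finset.sum_congr rfl fun b hb ↦ ?_
  have hbg := Nat.dvd_of_mem_divisors hb
  have hb0 : 0 < b := Nat.pos_of_mem_divisors hb
  obtain ⟨x, rfl⟩ := hbg.trans (Nat.gcd_dvd_left _ _)
  obtain ⟨y, rfl⟩ := hbg.trans (Nat.gcd_dvd_right _ _)
  rw [Nat.mul_div_cancel_left _ hb0, Nat.mul_div_cancel_left _ hb0, Nat.gcd_mul_left,
    Nat.mul_div_cancel_left _ hb0,
    hHecke x y (Nat.pos_of_mul_pos_left hm) (Nat.pos_of_mul_pos_left hn), mul_assoc,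
    Finset.mul_sum]
  congr 1
  refine Finset.sum_congr rfl fun d _ ↦ ?_
  rw [show b * x * (b * y) = b ^ 2 * (x * y) by ring, mul_pow,
    Nat.mul_div_mul_left _ _ (by positivity)]
  push_cast
  rw [map_mul]
  ring

theorem summable_norm_mul_cpow_neg {f : ℕ → ℂ} {C θ : ℝ} {s : ℂ} (hθ : 0 ≤ θ)
    (hf : ∀ n : ℕ, 0 < n → ‖f n‖ ≤ C * (n : ℝ) ^ θ) (hs : θ + 1 < s.re) :
    Summable fun n : ℕ ↦ ‖f n * (n : ℂ) ^ (-s)‖ := by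
  have h : LSeriesSummable f s := LSeriesSummable_of_le_const_mul_rpow hs
    ⟨C, fun n hn ↦ by rw [add_sub_cancel_right]; exact hf n (Nat.pos_of_ne_zero hn)⟩
  refine h.norm.congr fun n ↦ ?_
  rcases eq_or_ne n 0 with rfl | hn
  · have : -s ≠ 0 := fun h ↦ by
      rw [neg_eq_zero] at h
      rw [h, Complex.zero_re] at hs
      linarith
    simp [Complex.zero_cpow this]
  · rw [LSeries.term_of_ne_zero hn, Complex.cpow_neg, div_eq_mul_inv]

namespace DirichletCharacter

variable {D : ℕ} {χ : DirichletCharacter ℂ D}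

theorem hasSum_kloosTerm [NeZero D] (hD : 1 < D) (hquad : χ ^ 2 = 1) (hprim : χ.IsPrimitive)
    (heven : χ (-1) = 1) (m : ℕ) {s : ℂ}
    (hsum : Summable fun c : ℕ ↦ ‖((ArithmeticFunction.moebius c : ℤ) : ℂ) * χ (c : ZMod D) *
      (c : ℂ) ^ (-(2 * s))‖) :
    HasSum (fun c ↦ kloosTerm D χ m c s) (gaussSumOf χ * (D : ℂ) ^ (-(2 * s)) *
      (∑' c : ℕ, ((ArithmeticFunction.moebius c : ℤ) : ℂ) * χ (c : ZMod D) *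
        (c : ℂ) ^ (-(2 * s))) *
      ∑ p ∈ m.divisorsAntidiagonal, (p.1 : ℂ) ^ (-(2 * s)) * p.1 * χ (p.2 : ZMod D)) := by
  set M : ℕ → ℂ := fun c ↦ ((ArithmeticFunction.moebius c : ℤ) : ℂ) * χ (c : ZMod D) *
    (c : ℂ) ^ (-(2 * s)) with hM
  set T : ℕ → ℂ := fun k ↦ (k : ℂ) ^ (-(2 * s)) *
    (if k ∣ m then k * χ ((m / k : ℕ) : ZMod D) * gaussSumOf χ else 0) with hT
  have hχ0 : χ 0 = 0 := by
    have : Fact (1 < D) := ⟨hD⟩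
    exact χ.map_nonunit not_isUnit_zero
  have hT0 : ∀ k ∉ m.divisors, T k = 0 := by
    intro k hk
    rw [hT]
    simp only
    split_ifs with h
    · rcases eq_or_ne m 0 with rfl | hm
      · simp [hχ0]
      · exact absurd (Nat.mem_divisors.mpr ⟨h, hm⟩) hk
    · simp
  have hTsum : ∑' k, T k = gaussSumOf χ *
      ∑ p ∈ m.divisorsAntidiagonal, (p.1 : ℂ) ^ (-(2 * s)) * p.1 * χ (p.2 : ZMod D) := by
    rw [tsum_eq_sum hT0, Nat.sum_divisorsAntidiagonal
      (fun k n ↦ (k : ℂ) ^ (-(2 * s)) * k * χ (n : ZMod D)), Finset.mul_sum]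
    refine Finset.sum_congr rfl fun k hk ↦ ?_
    rw [hT]
    simp only
    rw [if_pos (Nat.dvd_of_mem_divisors hk)]
    ring
  have hTs : Summable fun k ↦ ‖T k‖ :=
    summable_of_ne_finset_zero (s := m.divisors) fun k hk ↦ by rw [hT0 k hk, norm_zero]
  have hterm : ∀ r, kloosTerm D χ m (D * r) s = (D : ℂ) ^ (-(2 * s)) *
      ∑ p ∈ r.divisorsAntidiagonal, M p.1 * T p.2 := by
    intro r
    rcases eq_or_ne r 0 with rfl | hr
    · simp [kloosTerm]
    have : NeZero r := ⟨hr⟩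
    rw [kloosTerm_eq hquad heven m (D * r) (dvd_mul_right _ _),
      sum_coprime_mul_stdAddChar hquad hprim, Nat.cast_mul,
      Complex.natCast_mul_natCast_cpow, mul_assoc, Finset.mul_sum]
    congr 1
    refine Finset.sum_congr rfl fun p hp ↦ ?_
    rw [← (Nat.mem_divisorsAntidiagonal.mp hp).1, Nat.cast_mul,
      Complex.natCast_mul_natCast_cpow]
    simp only [hM, hT]
    ring
  have hA := hasSum_sum_divisorsAntidiagonal (F := fun p ↦ M p.1 * T p.2)
    (summable_mul_of_summable_norm hsum hTs) (by
      intro a b hab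
      rcases mul_eq_zero.mp hab with rfl | rfl <;> simp [hM, hT])
  rw [← tsum_mul_tsum_of_summable_norm hsum hTs, hTsum] at hA
  have hinj : Function.Injective fun r : ℕ ↦ D * r := fun _ _ h ↦
    Nat.eq_of_mul_eq_mul_left (NeZero.pos D) h
  rw [← hinj.hasSum_iff]
  · refine (congrArg (HasSum · _) (funext hterm)).mpr ?_
    rw [mul_comm (gaussSumOf χ), mul_assoc, mul_assoc, mul_left_comm (gaussSumOf χ)]
    exact hA.mul_left _
  · intro c hc
    rw [kloosTerm, if_neg]
    rintro ⟨r, rfl⟩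
    exact hc ⟨r, rfl⟩

end DirichletCharacter
/-- The residue-term identity in spectral reciprocity:
`∑_{m≥1} λ(m) m^{-(1−s₁+s₂)} ∑_{D ∣ c} c^{-2s₁} ∑_{d ∈ (ℤ/cℤ)ˣ} χ(d) e(−m d̄/c)
  = τ(χ) D^{-2s₁} (∑ λ(n) n^{-(s₁+s₂)}) (∑ λ(n) χ(n) n^{-(1−s₁+s₂)})
    (∑_{(b,D)=1} μ(b) b^{-(1+2s₂)}) (∑ μ(c) χ(c) c^{-2s₁})`,
all sums converging absolutely. -/
theorem stmt_13 (D : ℕ) [NeZero D] (hD : 1 < D) (hsf : Squarefree D) (hmod : D % 4 = 1)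
    (χ : DirichletCharacter ℂ D) (hquad : χ ^ 2 = 1) (hprim : χ.IsPrimitive)
    (θ C : ℝ) (hθ0 : 0 ≤ θ) (hθ : θ < 1 / 4) (hC : 0 < C)
    (lam : ℕ → ℂ) (hlam1 : lam 1 = 1)
    (hbound : ∀ n : ℕ, 0 < n → ‖lam n‖ ≤ C * (n : ℝ) ^ θ)
    (hHecke : ∀ m n : ℕ, 0 < m → 0 < n →
      lam m * lam n = ∑ d ∈ (Nat.gcd m n).divisors, χ (d : ZMod D) * lam (m * n / d ^ 2))
    (hselftwist : ∀ n : ℕ, 0 < n → Nat.Coprime n D → lam n * χ (n : ZMod D) = lam n)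
    (s₁ s₂ : ℂ) (hs₁l : 5 / 4 < s₁.re) (hs₁u : s₁.re < 3 / 2)
    (hs₂l : s₁.re + θ < s₂.re) (hs₂u : s₂.re < 3 / 2) :
    (∀ m : ℕ, Summable fun c : ℕ => ‖kloosTerm D χ m c s₁‖) ∧
    (Summable fun m : ℕ =>
      ‖lam m * (m : ℂ) ^ (-(1 - s₁ + s₂)) * ∑' c : ℕ, kloosTerm D χ m c s₁‖) ∧
    (Summable fun n : ℕ => ‖lam n * (n : ℂ) ^ (-(s₁ + s₂))‖) ∧
    (Summable fun n : ℕ => ‖lam n * χ (n : ZMod D) * (n : ℂ) ^ (-(1 - s₁ + s₂))‖) ∧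
    (Summable fun b : ℕ =>
      ‖if Nat.Coprime b D then
          ((ArithmeticFunction.moebius b : ℤ) : ℂ) * (b : ℂ) ^ (-(1 + 2 * s₂)) else 0‖) ∧
    (Summable fun c : ℕ =>
      ‖((ArithmeticFunction.moebius c : ℤ) : ℂ) * χ (c : ZMod D) * (c : ℂ) ^ (-(2 * s₁))‖) ∧
    (∑' m : ℕ, lam m * (m : ℂ) ^ (-(1 - s₁ + s₂)) * ∑' c : ℕ, kloosTerm D χ m c s₁) =
      gaussSumOf χ * (D : ℂ) ^ (-(2 * s₁)) *
        (∑' n : ℕ, lam n * (n : ℂ) ^ (-(s₁ + s₂))) *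
        (∑' n : ℕ, lam n * χ (n : ZMod D) * (n : ℂ) ^ (-(1 - s₁ + s₂))) *
        (∑' b : ℕ, if Nat.Coprime b D then
          ((ArithmeticFunction.moebius b : ℤ) : ℂ) * (b : ℂ) ^ (-(1 + 2 * s₂)) else 0) *
        (∑' c : ℕ,
          ((ArithmeticFunction.moebius c : ℤ) : ℂ) * χ (c : ZMod D) * (c : ℂ) ^ (-(2 * s₁))) := by
  have heven := DirichletCharacter.apply_neg_one_of_isPrimitive_of_sq_eq_one hquad hprim hsf hmod
  have hχle : ∀ n : ℕ, ‖χ (n : ZMod D)‖ ≤ 1 := fun n ↦ χ.norm_le_one _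
  have hμle : ∀ n : ℕ, ‖((ArithmeticFunction.moebius n : ℤ) : ℂ)‖ ≤ 1 := fun n ↦ by
    rw [Complex.norm_intCast]
    exact_mod_cast ArithmeticFunction.abs_moebius_le_one
  have hre_u : θ + 1 < (s₁ + s₂).re := by rw [Complex.add_re]; linarith
  have hre_w : θ + 1 < (1 - s₁ + s₂).re := by
    rw [Complex.add_re, Complex.sub_re, Complex.one_re]; linarith
  have hre_v : 0 + 1 < (1 + 2 * s₂).re := by simp; linarith
  have hre_t : 0 + 1 < (2 * s₁).re := by simp; linarith
  have hu0 : ((0 : ℕ) : ℂ) ^ (-(s₁ + s₂)) = 0 := by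
    rw [Nat.cast_zero]
    refine Complex.zero_cpow fun h ↦ ?_
    rw [neg_eq_zero] at h
    rw [h, Complex.zero_re] at hre_u
    linarith
  have hw0 : ((0 : ℕ) : ℂ) ^ (-(1 - s₁ + s₂)) = 0 := by
    rw [Nat.cast_zero]
    refine Complex.zero_cpow fun h ↦ ?_
    rw [neg_eq_zero] at h
    rw [h, Complex.zero_re] at hre_w
    linarith
  have hA := summable_norm_mul_cpow_neg hθ0 hbound hre_u
  have hB : Summable fun n : ℕ ↦
      ‖lam n * χ (n : ZMod D) * (n : ℂ) ^ (-(1 - s₁ + s₂))‖ :=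
    summable_norm_mul_cpow_neg (f := fun n ↦ lam n * χ (n : ZMod D)) hθ0 (fun n hn ↦ by
      rw [norm_mul]
      exact (mul_le_of_le_one_right (norm_nonneg _) (hχle n)).trans (hbound n hn)) hre_w
  have hV : Summable fun b : ℕ ↦ ‖if Nat.Coprime b D then
      ((ArithmeticFunction.moebius b : ℤ) : ℂ) * (b : ℂ) ^ (-(1 + 2 * s₂)) else 0‖ := by
    refine (summable_norm_mul_cpow_neg
      (f := fun n ↦ ((ArithmeticFunction.moebius n : ℤ) : ℂ)) (C := 1) le_rfl
      (fun n _ ↦ by simpa using hμle n) hre_v).of_nonneg_of_le (fun _ ↦ norm_nonneg _) fun b ↦ ?_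
    split_ifs
    · exact le_rfl
    · rw [norm_zero]; exact norm_nonneg _
  have hM : Summable fun c : ℕ ↦ ‖((ArithmeticFunction.moebius c : ℤ) : ℂ) * χ (c : ZMod D) *
      (c : ℂ) ^ (-(2 * s₁))‖ :=
    summable_norm_mul_cpow_neg
      (f := fun n ↦ ((ArithmeticFunction.moebius n : ℤ) : ℂ) * χ (n : ZMod D)) (C := 1) le_rfl
      (fun n _ ↦ by
        rw [norm_mul]
        simpa using mul_le_one₀ (hμle n) (norm_nonneg _) (hχle n)) hre_t
  have hK := fun m ↦ DirichletCharacter.hasSum_kloosTerm hD hquad hprim heven m hM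
  set a : ℕ → ℂ := fun n ↦ lam n * (n : ℂ) ^ (-(s₁ + s₂)) with ha
  set b : ℕ → ℂ := fun n ↦ lam n * χ (n : ZMod D) * (n : ℂ) ^ (-(1 - s₁ + s₂)) with hb
  set v : ℕ → ℂ := fun b ↦ if Nat.Coprime b D then
    ((ArithmeticFunction.moebius b : ℤ) : ℂ) * (b : ℂ) ^ (-(1 + 2 * s₂)) else 0 with hv
  set K : ℂ := gaussSumOf χ * (D : ℂ) ^ (-(2 * s₁)) * ∑' c : ℕ,
    ((ArithmeticFunction.moebius c : ℤ) : ℂ) * χ (c : ZMod D) * (c : ℂ) ^ (-(2 * s₁)) with hKdef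
  have ha0 : a 0 = 0 := by simp only [ha, hu0, mul_zero]
  have hb0 : b 0 = 0 := by simp only [hb, hw0, mul_zero]
  have hv0 : v 0 = 0 := by simp [hv]
  have hAB := hA.mul_norm hB
  have hG := hasSum_sum_divisors_gcd (F := fun t ↦ v t.1 * (a t.2.1 * b t.2.2))
    (summable_mul_of_summable_norm (f := v) (g := fun p : ℕ × ℕ ↦ a p.1 * b p.2) hV hAB) (by
      rintro b x y (rfl | rfl | rfl) <;> simp [ha0, hb0, hv0])
  rw [← tsum_mul_tsum_of_summable_norm (f := v) (g := fun p : ℕ × ℕ ↦ a p.1 * b p.2) hV hAB,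
    ← tsum_mul_tsum_of_summable_norm hA hB] at hG
  have hGeq : ∀ q : ℕ × ℕ, ∑ d ∈ (Nat.gcd q.1 q.2).divisors, v d * (a (q.1 / d) * b (q.2 / d)) =
      lam (q.1 * q.2) * χ (q.2 : ZMod D) *
        ((q.1 : ℂ) ^ (-(s₁ + s₂)) * (q.2 : ℂ) ^ (-(1 - s₁ + s₂))) := by
    rintro ⟨m, n⟩
    simp only
    rcases Nat.eq_zero_or_pos m with rfl | hm
    · simp only [Nat.zero_div, ha0, hu0, zero_mul, mul_zero, Finset.sum_const_zero]
    rcases Nat.eq_zero_or_pos n with rfl | hn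
    · simp only [Nat.zero_div, hb0, hw0, mul_zero, Finset.sum_const_zero]
    rw [← sum_moebius_mul_of_hecke hHecke hm hn, Finset.sum_mul, Finset.sum_mul]
    refine Finset.sum_congr rfl fun d hd ↦ ?_
    have hdg := Nat.dvd_of_mem_divisors hd
    have hd0 : 0 < d := Nat.pos_of_mem_divisors hd
    obtain ⟨x, rfl⟩ := hdg.trans (Nat.gcd_dvd_left _ _)
    obtain ⟨y, rfl⟩ := hdg.trans (Nat.gcd_dvd_right _ _)
    rw [Nat.mul_div_cancel_left _ hd0, Nat.mul_div_cancel_left _ hd0]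
    have hpow : (d : ℂ) ^ (-(1 + 2 * s₂)) =
        (d : ℂ) ^ (-(s₁ + s₂)) * (d : ℂ) ^ (-(1 - s₁ + s₂)) := by
      rw [← Complex.cpow_add _ _ (Nat.cast_ne_zero.mpr hd0.ne')]
      congr 1; ring
    simp only [ha, hb, hv, Nat.cast_mul, Complex.natCast_mul_natCast_cpow, map_mul]
    split_ifs with hcop
    · have hsq : χ (d : ZMod D) ^ 2 = 1 := DirichletCharacter.sq_apply_eq_one_of_ne_zero hquad
        (((ZMod.isUnit_iff_coprime d D).mpr hcop).map χ).ne_zero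
      rw [hpow]
      linear_combination (-(((ArithmeticFunction.moebius d : ℤ) : ℂ) *
        ((d : ℂ) ^ (-(s₁ + s₂)) * (d : ℂ) ^ (-(1 - s₁ + s₂))) *
        (lam x * (x : ℂ) ^ (-(s₁ + s₂)) *
          (lam y * χ (y : ZMod D) * (y : ℂ) ^ (-(1 - s₁ + s₂)))))) * hsq
    · rw [χ.map_nonunit (mt (ZMod.isUnit_iff_coprime d D).mp hcop)]
      ring
  simp only [hGeq] at hG
  have hH := hasSum_sum_divisorsAntidiagonal hG.summable (by
    intro m n hmn
    rcases mul_eq_zero.mp hmn with rfl | rfl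
    · simp only [hu0, zero_mul, mul_zero]
    · simp only [hw0, mul_zero])
  rw [hG.tsum_eq] at hH
  have hL : ∀ m : ℕ, lam m * (m : ℂ) ^ (-(1 - s₁ + s₂)) * ∑' c : ℕ, kloosTerm D χ m c s₁ =
      K * ∑ q ∈ m.divisorsAntidiagonal, lam (q.1 * q.2) * χ (q.2 : ZMod D) *
        ((q.1 : ℂ) ^ (-(s₁ + s₂)) * (q.2 : ℂ) ^ (-(1 - s₁ + s₂))) := by
    intro m
    rw [(hK m).tsum_eq, mul_left_comm, Finset.mul_sum]
    congr 1
    refine Finset.sum_congr rfl fun q hq ↦ ?_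
    obtain ⟨hq1, hq2⟩ := Nat.mem_divisorsAntidiagonal.mp hq
    have hq0 : (q.1 : ℂ) ≠ 0 := by
      rintro h
      rw [Nat.cast_eq_zero] at h
      rw [h, zero_mul] at hq1
      exact hq2 hq1.symm
    have hpow : (q.1 : ℂ) ^ (-(s₁ + s₂)) =
        (q.1 : ℂ) ^ (-(1 - s₁ + s₂)) * ((q.1 : ℂ) ^ (-(2 * s₁)) * q.1) := by
      nth_rewrite 4 [← Complex.cpow_one (q.1 : ℂ)]
      rw [← Complex.cpow_add _ _ hq0, ← Complex.cpow_add _ _ hq0]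
      congr 1; ring
    rw [← hq1, Nat.cast_mul, Complex.natCast_mul_natCast_cpow, hpow]
    ring
  have hfinal := hH.mul_left K
  simp only [← hL] at hfinal
  refine ⟨fun m ↦ (hK m).summable.norm, hfinal.summable.norm, hA, hB, hV, hM, ?_⟩
  rw [hfinal.tsum_eq, hKdef]
  ring
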